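/- Let d, M ≥ 1, let σ_1, …, σ_M > 0, and let μ be a probability measure on ℝ^d with ∫ ‖x‖ dμ(x) < ∞. Define the Gaussian M-density p_Y(y) = ∫ ∏_{m=1}^M (2πσ_m²)^{-d/2} exp(−‖y_m − x‖²/(2σ_m²)) dμ(x). Then for every y ∈ (ℝ^d)^M and all indices m, m' ∈ {1,…,M}, one has y_m + σ_m² ∇_{y_m} log p_Y(y) = y_{m'} + σ_{m'}² ∇_{y_{m'}} log p_Y(y). -/

import Mathlib

open MeasureTheory Finset

/-- The Gaussian multimeasurement noise-model kernel
`p(y|x) = ∏_{m=1}^M (2πσ_m²)^{-d/2} exp(−‖y_m − x‖²/(2σ_m²))`. -/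
noncomputable def mnmKernel (d M : ℕ) (σ : Fin M → ℝ)
    (y : Fin M → EuclideanSpace ℝ (Fin d)) (x : EuclideanSpace ℝ (Fin d)) : ℝ :=
  ∏ m, (2 * Real.pi * σ m ^ 2) ^ (-(d : ℝ) / 2) *
    Real.exp (-‖y m - x‖ ^ 2 / (2 * σ m ^ 2))

/-- The Gaussian M-density `p_Y(y) = ∫ p(y|x) dμ(x)`. -/
noncomputable def mDensity (d M : ℕ) (σ : Fin M → ℝ)
    (μ : Measure (EuclideanSpace ℝ (Fin d))) (y : Fin M → EuclideanSpace ℝ (Fin d)) : ℝ :=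
  ∫ x, mnmKernel d M σ y x ∂μ

/-- The constant bounding the kernel `mnmKernel`. -/
noncomputable def mnmKernelBound (d M : ℕ) (σ : Fin M → ℝ) : ℝ :=
  ∏ m, (2 * Real.pi * σ m ^ 2) ^ (-(d : ℝ) / 2)

lemma mnmKernel_pos {d M : ℕ} {σ : Fin M → ℝ} (hσ : ∀ m, 0 < σ m)
    (y : Fin M → EuclideanSpace ℝ (Fin d)) (x : EuclideanSpace ℝ (Fin d)) :
    0 < mnmKernel d M σ y x := by
  refine Finset.prod_pos fun m _ => ?_
  have := hσ m
  positivity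

lemma mnmKernel_le {d M : ℕ} {σ : Fin M → ℝ} (hσ : ∀ m, 0 < σ m)
    (y : Fin M → EuclideanSpace ℝ (Fin d)) (x : EuclideanSpace ℝ (Fin d)) :
    mnmKernel d M σ y x ≤ mnmKernelBound d M σ := by
  refine Finset.prod_le_prod (fun m _ => ?_) fun m _ => ?_
  · have := hσ m
    positivity
  · have := hσ m
    refine mul_le_of_le_one_right (by positivity) (Real.exp_le_one_iff.2 ?_)
    rw [neg_div, neg_nonpos]
    positivity

lemma continuous_mnmKernel (d M : ℕ) (σ : Fin M → ℝ)
    (y : Fin M → EuclideanSpace ℝ (Fin d)) : Continuous (mnmKernel d M σ y) := by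
  unfold mnmKernel
  fun_prop

lemma integrable_mnmKernel {d M : ℕ} {σ : Fin M → ℝ} (hσ : ∀ m, 0 < σ m)
    (μ : Measure (EuclideanSpace ℝ (Fin d))) [IsFiniteMeasure μ]
    (y : Fin M → EuclideanSpace ℝ (Fin d)) : Integrable (mnmKernel d M σ y) μ := by
  refine Integrable.of_bound (continuous_mnmKernel d M σ y).aestronglyMeasurable
    (mnmKernelBound d M σ) (ae_of_all _ fun x => ?_)
  rw [Real.norm_of_nonneg (mnmKernel_pos hσ y x).le]
  exact mnmKernel_le hσ y x

lemma mDensity_pos {d M : ℕ} {σ : Fin M → ℝ} (hσ : ∀ m, 0 < σ m)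
    (μ : Measure (EuclideanSpace ℝ (Fin d))) [IsProbabilityMeasure μ]
    (y : Fin M → EuclideanSpace ℝ (Fin d)) : 0 < mDensity d M σ μ y := by
  unfold mDensity
  rw [integral_pos_iff_support_of_nonneg (fun x => (mnmKernel_pos hσ y x).le)
    (integrable_mnmKernel hσ μ y)]
  have : Function.support (mnmKernel d M σ y) = Set.univ :=
    Set.eq_univ_of_forall fun x => (mnmKernel_pos hσ y x).ne'
  simp [this]

lemma integrable_mnmKernel_smul {d M : ℕ} {σ : Fin M → ℝ} (hσ : ∀ m, 0 < σ m)
    {μ : Measure (EuclideanSpace ℝ (Fin d))}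
    (hmom : Integrable (fun x => ‖x‖) μ) (y : Fin M → EuclideanSpace ℝ (Fin d)) :
    Integrable (fun x => mnmKernel d M σ y x • x) μ := by
  refine (hmom.const_mul (mnmKernelBound d M σ)).mono'
    ((continuous_mnmKernel d M σ y).smul continuous_id).aestronglyMeasurable
    (ae_of_all _ fun x => ?_)
  rw [norm_smul, Real.norm_of_nonneg (mnmKernel_pos hσ y x).le]
  gcongr
  exact mnmKernel_le hσ y x

lemma hasGradientAt_mnmKernel_update {d M : ℕ} {σ : Fin M → ℝ} {m : Fin M} (hσ : σ m ≠ 0)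
    (y : Fin M → EuclideanSpace ℝ (Fin d)) (x z : EuclideanSpace ℝ (Fin d)) :
    HasGradientAt (fun z => mnmKernel d M σ (Function.update y m z) x)
      (mnmKernel d M σ (Function.update y m z) x • (σ m ^ 2)⁻¹ • (x - z)) z := by
  set c : ℝ := (2 * Real.pi * σ m ^ 2) ^ (-(d : ℝ) / 2) *
    ∏ i ∈ Finset.univ.erase m, (2 * Real.pi * σ i ^ 2) ^ (-(d : ℝ) / 2) *
      Real.exp (-‖y i - x‖ ^ 2 / (2 * σ i ^ 2)) with hc
  have hfac : ∀ w, mnmKernel d M σ (Function.update y m w) x =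
      c * Real.exp (-‖w - x‖ ^ 2 / (2 * σ m ^ 2)) := by
    intro w
    have hrest : ∏ i ∈ Finset.univ.erase m, (2 * Real.pi * σ i ^ 2) ^ (-(d : ℝ) / 2) *
        Real.exp (-‖Function.update y m w i - x‖ ^ 2 / (2 * σ i ^ 2)) =
        ∏ i ∈ Finset.univ.erase m, (2 * Real.pi * σ i ^ 2) ^ (-(d : ℝ) / 2) *
        Real.exp (-‖y i - x‖ ^ 2 / (2 * σ i ^ 2)) :=
      Finset.prod_congr rfl fun i hi => by
        rw [Function.update_of_ne (Finset.ne_of_mem_erase hi)]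
    rw [mnmKernel, ← Finset.mul_prod_erase _ _ (Finset.mem_univ m), hrest, hc,
      Function.update_self]
    ring
  simp_rw [hfac]
  rw [hasGradientAt_iff_hasFDerivAt]
  have h := ((((hasFDerivAt_id z).sub_const x).norm_sq.neg.mul_const
    (2 * σ m ^ 2)⁻¹).exp).const_mul c
  simp only [← div_eq_mul_inv] at h
  refine h.congr_fderiv ?_
  ext v
  simp
  field_simp
  ring

/-- Differentiation under the integral sign for the Gaussian `M`-density in one channel. -/
lemma hasGradientAt_mDensity_update {d M : ℕ} {σ : Fin M → ℝ} (hσ : ∀ m, 0 < σ m)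
    {μ : Measure (EuclideanSpace ℝ (Fin d))} [IsFiniteMeasure μ]
    (hmom : Integrable (fun x => ‖x‖) μ)
    (y : Fin M → EuclideanSpace ℝ (Fin d)) (m : Fin M) :
    HasGradientAt (fun z => mDensity d M σ μ (Function.update y m z))
      (∫ x, mnmKernel d M σ y x • (σ m ^ 2)⁻¹ • (x - y m) ∂μ) (y m) := by
  let G : EuclideanSpace ℝ (Fin d) → EuclideanSpace ℝ (Fin d) → EuclideanSpace ℝ (Fin d) :=
    fun z x => mnmKernel d M σ (Function.update y m z) x • (σ m ^ 2)⁻¹ • (x - z)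
  have hGcont : ∀ z, Continuous (G z) := fun z =>
    (continuous_mnmKernel d M σ _).smul (by fun_prop)
  let bound : EuclideanSpace ℝ (Fin d) → ℝ :=
    fun x => mnmKernelBound d M σ * ((σ m ^ 2)⁻¹ * (‖x‖ + (‖y m‖ + 1)))
  have hbound : Integrable bound μ :=
    ((hmom.add (integrable_const _)).const_mul _).const_mul _
  have hle : ∀ x, ∀ z ∈ Metric.ball (y m) 1, ‖G z x‖ ≤ bound x := by
    intro x z hz
    have hz' : ‖z‖ ≤ ‖y m‖ + 1 := by
      have := norm_le_norm_add_norm_sub' z (y m)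
      rw [mem_ball_iff_norm] at hz
      linarith
    have hK := mnmKernel_le hσ (Function.update y m z) x
    have hK0 := (mnmKernel_pos hσ (Function.update y m z) x).le
    simp only [G, bound]
    rw [norm_smul, norm_smul, Real.norm_of_nonneg hK0,
      Real.norm_of_nonneg (by positivity : 0 ≤ (σ m ^ 2)⁻¹)]
    refine mul_le_mul hK ?_ (by positivity) (hK0.trans hK)
    gcongr
    exact (norm_sub_le x z).trans (by gcongr)
  have hGint : Integrable (G (y m)) μ :=
    hbound.mono' (hGcont _).aestronglyMeasurable
      (ae_of_all _ fun x => hle x _ (Metric.mem_ball_self one_pos))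
  have hG : ∀ x, G (y m) x = mnmKernel d M σ y x • (σ m ^ 2)⁻¹ • (x - y m) := by
    intro x
    simp [G]
  simp_rw [← hG]
  rw [hasGradientAt_iff_hasFDerivAt]
  have hmeas : AEStronglyMeasurable
      (fun x => InnerProductSpace.toDual ℝ (EuclideanSpace ℝ (Fin d)) (G (y m) x)) μ :=
    ((LinearIsometryEquiv.continuous _).comp (hGcont _)).aestronglyMeasurable
  have h := hasFDerivAt_integral_of_dominated_of_fderiv_le (μ := μ) (𝕜 := ℝ)
    (F := fun z x => mnmKernel d M σ (Function.update y m z) x)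
    (F' := fun z x => InnerProductSpace.toDual ℝ _ (G z x)) (bound := bound)
    (Metric.ball_mem_nhds (y m) one_pos)
    (Filter.Eventually.of_forall fun z => (continuous_mnmKernel d M σ _).aestronglyMeasurable)
    (integrable_mnmKernel hσ μ _) hmeas
    (ae_of_all _ fun x z hz => by
      rw [LinearIsometryEquiv.norm_map]
      exact hle x z hz) hbound
    (ae_of_all _ fun x z _ =>
      (hasGradientAt_mnmKernel_update (hσ m).ne' y x z).hasFDerivAt)
  refine h.congr_fderiv ?_
  ext1 v
  have hint : Integrable
      (fun x => InnerProductSpace.toDual ℝ (EuclideanSpace ℝ (Fin d)) (G (y m) x)) μ :=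
    hGint.norm.mono' hmeas (ae_of_all _ fun x => by rw [LinearIsometryEquiv.norm_map])
  rw [ContinuousLinearMap.integral_apply hint, InnerProductSpace.toDual_apply_apply,
    real_inner_comm, ← integral_inner hGint]
  exact integral_congr_ae (ae_of_all _ fun x =>
    InnerProductSpace.toDual_apply_apply.trans (real_inner_comm _ _))

/-- The multi-channel Tweedie formula: the score in any channel yields the posterior mean. -/
lemma add_smul_gradient_mDensity_eq {d M : ℕ} {σ : Fin M → ℝ} (hσ : ∀ m, 0 < σ m)
    {μ : Measure (EuclideanSpace ℝ (Fin d))} [IsProbabilityMeasure μ]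
    (hmom : Integrable (fun x => ‖x‖) μ)
    (y : Fin M → EuclideanSpace ℝ (Fin d)) (m : Fin M) :
    y m + (σ m ^ 2) •
        ((mDensity d M σ μ y)⁻¹ •
          gradient (fun z => mDensity d M σ μ (Function.update y m z)) (y m)) =
      (mDensity d M σ μ y)⁻¹ • ∫ x, mnmKernel d M σ y x • x ∂μ := by
  have hs : σ m ^ 2 ≠ 0 := pow_ne_zero _ (hσ m).ne'
  have hp := (mDensity_pos hσ μ y).ne'
  have hint : ∫ x, mnmKernel d M σ y x • (σ m ^ 2)⁻¹ • (x - y m) ∂μ =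
      (σ m ^ 2)⁻¹ • ((∫ x, mnmKernel d M σ y x • x ∂μ) - mDensity d M σ μ y • y m) := by
    rw [mDensity, ← integral_smul_const, ← integral_sub (integrable_mnmKernel_smul hσ hmom y)
      ((integrable_mnmKernel hσ μ y).smul_const _), ← integral_smul]
    simp_rw [← smul_sub]
    exact integral_congr_ae (ae_of_all _ fun x => smul_comm _ _ _)
  rw [(hasGradientAt_mDensity_update hσ hmom y m).gradient, hint, smul_comm (σ m ^ 2),
    smul_inv_smul₀ hs, smul_sub, inv_smul_smul₀ hp]
  abel

/-- Cross-channel consistency: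
`y_m + σ_m² ∇_{y_m} log p_Y(y) = y_{m'} + σ_{m'}² ∇_{y_{m'}} log p_Y(y)`,
where `∇_{y_m} log p_Y(y) = (∇_{y_m} p_Y(y))/p_Y(y)`. -/
theorem score_channel_consistency (d M : ℕ) (hd : 1 ≤ d) (hM : 1 ≤ M)
    (σ : Fin M → ℝ) (hσ : ∀ m, 0 < σ m)
    (μ : Measure (EuclideanSpace ℝ (Fin d))) [IsProbabilityMeasure μ]
    (hmom : Integrable (fun x => ‖x‖) μ)
    (y : Fin M → EuclideanSpace ℝ (Fin d)) (m m' : Fin M) :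
    y m + (σ m ^ 2) •
        ((mDensity d M σ μ y)⁻¹ •
          gradient (fun z => mDensity d M σ μ (Function.update y m z)) (y m))
      = y m' + (σ m' ^ 2) •
          ((mDensity d M σ μ y)⁻¹ •
            gradient (fun z => mDensity d M σ μ (Function.update y m' z)) (y m')) := by
  rw [add_smul_gradient_mDensity_eq hσ hmom y m, add_smul_gradient_mDensity_eq hσ hmom y m']
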